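/- The ratio of the sup-norms of the positive and negative parts of the even Legendre polynomials satisfies lim_{n→∞} (sup_{x∈[0,1]} P_{2n,+}(x)) / (sup_{x∈[0,1]} P_{2n,-}(x)) = 1/|J₀(j₁)|; in particular this limit is at least 2.48. -/

import Mathlib

open MeasureTheory Filter

/-- The `n`-th Legendre polynomial, via Rodrigues formula:
`P_n(x) = (1/(2^n n!)) (d/dx)^n (x^2 - 1)^n`. -/
noncomputable def legP (n : ℕ) : ℝ → ℝ := fun x =>
  (1 / ((2 : ℝ) ^ n * (n.factorial : ℝ))) *
    iteratedDeriv n (fun y : ℝ => (y ^ 2 - 1) ^ n) x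

/-- Positive part of the `n`-th Legendre polynomial. -/
noncomputable def legPpos (n : ℕ) (x : ℝ) : ℝ := max (legP n x) 0

/-- Negative part of the `n`-th Legendre polynomial. -/
noncomputable def legPneg (n : ℕ) (x : ℝ) : ℝ := max (-legP n x) 0

/-- The Bessel function of the first kind of order 0. -/
noncomputable def besselJ0 (x : ℝ) : ℝ :=
  ∑' k : ℕ, (-1 : ℝ) ^ k * (x / 2) ^ (2 * k) / ((k.factorial : ℝ)) ^ 2

/-- The Bessel function of the first kind of order 1. -/
noncomputable def besselJ1 (x : ℝ) : ℝ :=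
  ∑' k : ℕ, (-1 : ℝ) ^ k * (x / 2) ^ (2 * k + 1) /
    ((k.factorial : ℝ) * ((k + 1).factorial : ℝ))


open Polynomial in
noncomputable def slp (N : ℕ) : ℝ[X] := (Polynomial.shiftedLegendre N).map (Int.castRingHom ℝ)

noncomputable def lam (N : ℕ) : ℝ := (N : ℝ) * ((N : ℝ) + 1)

noncomputable def aco (N k : ℕ) : ℝ := (N.choose k : ℝ) * ((N + k).choose N : ℝ) / lam N ^ k

noncomputable def BA (y : ℝ) : ℝ := ∑' k : ℕ, (-1 : ℝ) ^ k * y ^ k / ((k.factorial : ℝ)) ^ 2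

noncomputable def BB (y : ℝ) : ℝ :=
  ∑' k : ℕ, (-1 : ℝ) ^ k * y ^ k / ((k.factorial : ℝ) * ((k + 1).factorial : ℝ))

lemma J0_eq (x : ℝ) : besselJ0 x = BA (x ^ 2 / 4) := by
  unfold besselJ0 BA
  congr 1; ext k
  rw [pow_mul]; congr 3; ring

lemma J1_eq (x : ℝ) : besselJ1 x = x / 2 * BB (x ^ 2 / 4) := by
  unfold besselJ1 BB
  rw [← tsum_mul_left]
  congr 1; ext k
  rw [pow_succ, pow_mul, show (x/2)^2 = x^2/4 by ring]; ring

lemma legP_eq (N : ℕ) (u : ℝ) : legP N (1 - 2 * u) = (slp N).eval u := by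
  have h1 : ∀ q : Polynomial ℝ, ∀ n : ℕ, iteratedDeriv n (fun x => q.eval x)
      = fun x => (Polynomial.derivative^[n] q).eval x := by
    intro q n
    induction n with
    | zero => simp
    | succ n ih =>
      rw [iteratedDeriv_succ, ih]
      ext x
      rw [Polynomial.deriv, Function.iterate_succ_apply']
  set F : ℝ → ℝ := fun y : ℝ => (y ^ 2 - 1) ^ N with hF
  have hFc : ContDiff ℝ N F := by fun_prop
  set q : Polynomial ℝ := Polynomial.X ^ N * (1 - Polynomial.X) ^ N with hq
  have hH : (fun v : ℝ => (fun z => F (1 + z)) (-2 * v)) =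
      fun v => (-4 : ℝ) ^ N * q.eval v := by
    ext v
    simp only [hF, hq, Polynomial.eval_mul, Polynomial.eval_pow, Polynomial.eval_X,
      Polynomial.eval_sub, Polynomial.eval_one]
    rw [← mul_pow, ← mul_pow]; congr 1; ring
  have h2 := congrFun (congrArg (iteratedDeriv N) hH) u
  rw [iteratedDeriv_comp_const_mul (f := fun z => F (1 + z)) (by fun_prop), iteratedDeriv_const_mul_field, h1] at h2
  simp only [iteratedDeriv_comp_const_add] at h2
  have h3 := congrArg (fun r => (r.map (Int.castRingHom ℝ)).eval u)
    (Polynomial.factorial_mul_shiftedLegendre_eq N)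
  simp only [← Polynomial.iterate_derivative_map] at h3
  have h4 : (Polynomial.X ^ N * (1 - (Polynomial.X : Polynomial ℤ)) ^ N).map (Int.castRingHom ℝ) = q := by
    simp [hq]
  rw [h4] at h3
  simp only [Polynomial.map_mul, Polynomial.eval_mul, Polynomial.map_natCast, Polynomial.eval_natCast] at h3
  rw [← h3] at h2
  unfold legP
  have e : 1 - 2 * u = 1 + -2 * u := by ring
  rw [e]
  have h5 : (-4 : ℝ)^N = (-2)^N * 2^N := by rw [← mul_pow]; norm_num
  rw [h5, mul_assoc] at h2
  have h6 := mul_left_cancel₀ (pow_ne_zero N (by norm_num : (-2:ℝ) ≠ 0)) h2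
  change _ * iteratedDeriv N F _ = _
  rw [h6]
  have : (N.factorial : ℝ) ≠ 0 := by positivity
  unfold slp
  field_simp

lemma slp_coeff (N k : ℕ) : (slp N).coeff k = (-1) ^ k * N.choose k * (N + k).choose N := by
  simp [slp, Polynomial.coeff_map, Polynomial.coeff_shiftedLegendre]

lemma choose_rec (N k : ℕ) : ((k : ℝ) + 1) ^ 2 * ((N.choose (k+1) : ℝ) * ((N + (k+1)).choose N : ℝ))
    = (lam N - k * (k + 1)) * ((N.choose k : ℝ) * ((N + k).choose N : ℝ)) := by
  rcases lt_or_ge N k with h | h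
  · rw [Nat.choose_eq_zero_of_lt h, Nat.choose_eq_zero_of_lt (by omega)]; simp
  have h1 : (N.choose (k+1) : ℝ) * (k + 1) = N.choose k * ((N : ℝ) - k) := by
    have := Nat.choose_succ_right_eq N k
    have := congrArg (Nat.cast : ℕ → ℝ) this
    push_cast [Nat.cast_sub h] at this
    exact this
  have h2 : ((N + (k+1)).choose N : ℝ) * (k + 1) = (N + k).choose N * ((N : ℝ) + k + 1) := by
    have := Nat.add_one_mul_choose_eq (N + k) k
    have e1 : (N + (k+1)).choose N = (N + k + 1).choose (k + 1) := by
      rw [← add_assoc, ← Nat.choose_symm (by omega : k + 1 ≤ N + k + 1)]; congr 1; omega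
    have e2 : (N + k).choose N = (N + k).choose k := by
      rw [← Nat.choose_symm (by omega : k ≤ N + k)]; congr 1; omega
    rw [e1, e2]
    have := congrArg (Nat.cast : ℕ → ℝ) this
    push_cast at this
    linarith
  unfold lam
  calc _ = ((N.choose (k+1) : ℝ) * (k + 1)) * (((N + (k+1)).choose N : ℝ) * (k + 1)) := by ring
    _ = _ := by rw [h1, h2]; ring

lemma slp_ode (N : ℕ) : Polynomial.X * (1 - Polynomial.X) * (slp N).derivative.derivative
    + (1 - 2 * Polynomial.X) * (slp N).derivative + Polynomial.C (lam N) * slp N = 0 := by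
  have : Polynomial.X * (1 - Polynomial.X) * (slp N).derivative.derivative
    + (1 - 2 * Polynomial.X) * (slp N).derivative + Polynomial.C (lam N) * slp N
    = Polynomial.X * (slp N).derivative.derivative - Polynomial.X * (Polynomial.X * (slp N).derivative.derivative)
     + (slp N).derivative - Polynomial.C 2 * (Polynomial.X * (slp N).derivative) + Polynomial.C (lam N) * slp N := by
    rw [show (Polynomial.C 2 : Polynomial ℝ) = 2 from rfl]; ring
  rw [this]
  ext k
  have hr := choose_rec N k
  rcases k with _ | _ | k
  · simp [Polynomial.coeff_derivative, slp_coeff] at *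
    linarith
  · simp [Polynomial.coeff_derivative, Polynomial.coeff_X_mul, slp_coeff] at *
    norm_num at *
    linarith
  · simp [Polynomial.coeff_derivative, Polynomial.coeff_X_mul, slp_coeff, pow_succ] at *
    linear_combination ((-1)^k) * (-1) * hr

noncomputable def Son (N : ℕ) (u : ℝ) : ℝ :=
  (slp N).eval u ^ 2 + u * (1 - u) * ((slp N).derivative.eval u) ^ 2 / lam N

lemma lam_pos {N : ℕ} (hN : 0 < N) : 0 < lam N := by
  unfold lam; positivity

lemma Son_anti {N : ℕ} (hN : 0 < N) : AntitoneOn (Son N) (Set.Icc 0 (1/2)) := by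
  have hl := lam_pos hN
  have hd : ∀ u, HasDerivAt (Son N) (-(1 - 2 * u) * ((slp N).derivative.eval u) ^ 2 / lam N) u := by
    intro u
    have h1 := (slp N).hasDerivAt u
    have h2 := (slp N).derivative.hasDerivAt u
    have h3 : HasDerivAt (fun u : ℝ => u * (1 - u)) (1 * (1 - u) + u * (0 - 1)) u :=
      (hasDerivAt_id u).mul ((hasDerivAt_const u (1:ℝ)).sub (hasDerivAt_id u))
    have h4 := (h1.pow 2).add ((h3.mul (h2.pow 2)).div_const (lam N))
    have ho := congrArg (Polynomial.eval u) (slp_ode N)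
    simp at ho
    refine HasDerivAt.congr_deriv (f := Son N) h4 ?_
    simp
    field_simp
    linear_combination (2 * (slp N).derivative.eval u) * ho
  apply antitoneOn_of_deriv_nonpos (convex_Icc _ _)
  · exact fun u _ => (hd u).continuousAt.continuousWithinAt
  · exact fun u _ => (hd u).differentiableAt.differentiableWithinAt
  · intro u hu
    rw [interior_Icc] at hu
    rw [(hd u).deriv]
    apply div_nonpos_of_nonpos_of_nonneg _ hl.le
    have : 0 ≤ 1 - 2 * u := by linarith [hu.2]
    nlinarith [mul_nonneg this (sq_nonneg ((slp N).derivative.eval u))]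

lemma sq_le_Son {N : ℕ} (hN : 0 < N) {u : ℝ} (h0 : 0 ≤ u) (h1 : u ≤ 1/2) :
    (slp N).eval u ^ 2 ≤ Son N u := by
  unfold Son
  have := lam_pos hN
  have : 0 ≤ 1 - u := by linarith
  have : 0 ≤ u * (1 - u) * ((slp N).derivative.eval u) ^ 2 / lam N := by positivity
  linarith

lemma slp_zero (N : ℕ) : (slp N).eval 0 = 1 := by
  rw [← Polynomial.coeff_zero_eq_eval_zero, slp_coeff]; simp

lemma abs_slp_le {N : ℕ} (hN : 0 < N) {u : ℝ} (h0 : 0 ≤ u) (h1 : u ≤ 1/2) :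
    |(slp N).eval u| ≤ 1 := by
  have h := Son_anti hN (a := 0) ⟨le_rfl, by norm_num⟩ ⟨h0, h1⟩ h0
  have h' := sq_le_Son hN h0 h1
  have : Son N 0 = 1 := by simp [Son, slp_zero]
  rw [← sq_le_one_iff_abs_le_one]; linarith

lemma aco_nonneg (N k : ℕ) : 0 ≤ aco N k := by
  unfold aco lam; positivity

lemma aco_succ {N : ℕ} (hN : 0 < N) (k : ℕ) :
    aco N (k + 1) = aco N k * ((1 - k * (k + 1) / lam N) / ((k : ℝ) + 1) ^ 2) := by
  have hl := lam_pos hN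
  have := choose_rec N k
  unfold aco
  have h1 : ((k : ℝ) + 1) ≠ 0 := by positivity
  field_simp
  rw [pow_succ]
  linear_combination lam N ^ k * lam N * this

lemma aco_zero (N : ℕ) : aco N 0 = 1 := by simp [aco]

lemma aco_le {N : ℕ} (hN : 0 < N) (k : ℕ) : aco N k ≤ 1 / (k.factorial : ℝ) ^ 2 := by
  induction k with
  | zero => simp [aco_zero]
  | succ k ih =>
    have hl := lam_pos hN
    rw [aco_succ hN]
    have h1 : (1 - k * (k + 1) / lam N) ≤ 1 := by
      have : 0 ≤ (k:ℝ) * (k + 1) / lam N := by positivity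
      linarith
    calc _ ≤ aco N k * (1 / ((k : ℝ) + 1) ^ 2) := by
          have := aco_nonneg N k
          gcongr
      _ ≤ 1 / (k.factorial : ℝ) ^ 2 * (1 / ((k : ℝ) + 1) ^ 2) := by gcongr
      _ = _ := by rw [Nat.factorial_succ]; push_cast; field_simp

lemma lam_tendsto : Tendsto lam atTop atTop := by
  unfold lam
  exact (tendsto_natCast_atTop_atTop).atTop_mul_atTop₀
    (tendsto_atTop_add_const_right _ _ tendsto_natCast_atTop_atTop)

lemma aco_tendsto (k : ℕ) : Tendsto (fun N => aco N k) atTop (nhds (1 / (k.factorial : ℝ) ^ 2)) := by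
  induction k with
  | zero => simp [aco_zero]
  | succ k ih =>
    have h1 : Tendsto (fun N => aco N k * ((1 - k * (k + 1) / lam N) / ((k : ℝ) + 1) ^ 2)) atTop
        (nhds (1 / (k.factorial : ℝ) ^ 2 * ((1 - 0) / ((k : ℝ) + 1) ^ 2))) :=
      ih.mul ((tendsto_const_nhds.sub (tendsto_const_nhds.div_atTop lam_tendsto)).div_const _)
    have e : (1 / (k.factorial : ℝ) ^ 2 * ((1 - 0) / ((k : ℝ) + 1) ^ 2)) = 1 / ((k+1).factorial : ℝ) ^ 2 := by
      rw [Nat.factorial_succ]; push_cast; field_simp; ring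
    rw [e] at h1
    refine h1.congr' ?_
    filter_upwards [eventually_gt_atTop 0] with N hN
    rw [aco_succ hN]

lemma poly_tsum (p : Polynomial ℝ) (x : ℝ) : HasSum (fun k => p.coeff k * x ^ k) (p.eval x) := by
  rw [Polynomial.eval_eq_sum_range]
  apply hasSum_sum_of_ne_finset_zero
  intro k hk
  rw [Polynomial.coeff_eq_zero_of_natDegree_lt (by simpa using hk)]; simp

lemma slp_hasSum {N : ℕ} (hN : 0 < N) (y : ℝ) :
    HasSum (fun k => (-1 : ℝ) ^ k * aco N k * y ^ k) ((slp N).eval (y / lam N)) := by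
  have hl := lam_pos hN
  convert! poly_tsum (slp N) (y / lam N) using 2 with k
  rw [slp_coeff]; unfold aco; rw [div_pow]; field_simp

lemma slp'_hasSum {N : ℕ} (hN : 0 < N) (y : ℝ) :
    HasSum (fun k => (-1 : ℝ) ^ k * (-(aco N (k + 1) * (k + 1))) * y ^ k)
      ((slp N).derivative.eval (y / lam N) / lam N) := by
  have hl := lam_pos hN
  convert! (poly_tsum (slp N).derivative (y / lam N)).div_const (lam N) using 2 with k
  rw [Polynomial.coeff_derivative, slp_coeff]; unfold aco; rw [div_pow]; field_simp; ring

lemma fac_one_le (k : ℕ) : (1 : ℝ) ≤ k.factorial := by exact_mod_cast k.factorial_pos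

lemma summA (y : ℝ) : Summable (fun k : ℕ => (-1 : ℝ) ^ k * y ^ k / ((k.factorial : ℝ)) ^ 2) := by
  refine Summable.of_norm_bounded (Real.summable_pow_div_factorial |y|) fun k => ?_
  rw [norm_div, norm_mul, norm_pow, norm_pow]
  simp
  gcongr
  have := fac_one_le k
  nlinarith

lemma summB (y : ℝ) : Summable (fun k : ℕ => (-1 : ℝ) ^ k * y ^ k / ((k.factorial : ℝ) * ((k+1).factorial : ℝ))) := by
  refine Summable.of_norm_bounded (Real.summable_pow_div_factorial |y|) fun k => ?_
  rw [norm_div, norm_mul, norm_pow, norm_pow]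
  simp only [norm_neg, norm_one, one_pow, one_mul, norm_mul, RCLike.norm_natCast, Real.norm_eq_abs]
  gcongr
  have := fac_one_le k
  have := fac_one_le (k+1)
  nlinarith

/-- uniform error -/
noncomputable def err (Y : ℝ) (N : ℕ) : ℝ := ∑' k, |aco N k - 1 / (k.factorial : ℝ) ^ 2| * Y ^ k

lemma err_bound {Y : ℝ} (hY : 0 ≤ Y) {N : ℕ} (hN : 0 < N) (k : ℕ) :
    ‖|aco N k - 1 / (k.factorial : ℝ) ^ 2| * Y ^ k‖ ≤ Y ^ k / k.factorial := by
  have h1 := aco_nonneg N k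
  have h2 := aco_le hN k
  have h3 : 1 / (k.factorial : ℝ)^2 ≤ 1 / k.factorial := by
    have := fac_one_le k
    gcongr; nlinarith
  have h4 : |aco N k - 1 / (k.factorial : ℝ) ^ 2| ≤ 1 / (k.factorial : ℝ) := by
    rw [abs_le]; constructor
    · linarith
    · have : (0:ℝ) ≤ 1 / k.factorial := by positivity
      linarith
  rw [Real.norm_of_nonneg (by positivity)]
  calc _ ≤ 1 / (k.factorial : ℝ) * Y ^ k := by gcongr
    _ = _ := by ring

lemma err_tendsto {Y : ℝ} (hY : 0 ≤ Y) : Tendsto (err Y) atTop (nhds 0) := by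
  have := tendsto_tsum_of_dominated_convergence (𝓕 := atTop)
    (f := fun N k => |aco N k - 1 / (k.factorial : ℝ) ^ 2| * Y ^ k) (g := fun _ => 0)
    (Real.summable_pow_div_factorial Y) ?_ ?_
  · rw [tsum_zero] at this
    exact this
  · intro k
    have := (((aco_tendsto k).sub_const (1 / (k.factorial : ℝ) ^ 2)).abs).mul_const (Y ^ k)
    simpa using this
  · filter_upwards [eventually_gt_atTop 0] with N hN k
    exact err_bound hY hN k

lemma slp_err {Y y : ℝ} (hy : 0 ≤ y) (hyY : y ≤ Y) {N : ℕ} (hN : 0 < N) :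
    |(slp N).eval (y / lam N) - BA y| ≤ err Y N := by
  have h1 := (slp_hasSum hN y).sub (summA y).hasSum
  change HasSum _ ((slp N).eval (y / lam N) - BA y) at h1
  have hs : Summable (fun k => |aco N k - 1 / (k.factorial : ℝ) ^ 2| * Y ^ k) :=
    Summable.of_norm_bounded (Real.summable_pow_div_factorial Y) (err_bound (hy.trans hyY) hN)
  rw [← h1.tsum_eq, ← Real.norm_eq_abs]
  refine tsum_of_norm_bounded hs.hasSum fun k => ?_
  have : (-1 : ℝ) ^ k * aco N k * y ^ k - (-1) ^ k * y ^ k / (k.factorial : ℝ) ^ 2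
    = (-1)^k * ((aco N k - 1 / (k.factorial : ℝ) ^ 2) * y ^ k) := by ring
  rw [this, norm_mul, norm_pow, norm_neg, norm_one, one_pow, one_mul, norm_mul, Real.norm_eq_abs,
    norm_pow, Real.norm_of_nonneg hy]
  gcongr

lemma slp_tendsto {y : ℝ} (hy : 0 ≤ y) :
    Tendsto (fun N => (slp N).eval (y / lam N)) atTop (nhds (BA y)) := by
  rw [tendsto_iff_norm_sub_tendsto_zero]
  refine squeeze_zero' (Eventually.of_forall fun _ => norm_nonneg _) ?_ (err_tendsto hy)
  filter_upwards [eventually_gt_atTop 0] with N hN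
  exact slp_err hy le_rfl hN

lemma slp'_tendsto {y : ℝ} (hy : 0 ≤ y) :
    Tendsto (fun N => (slp N).derivative.eval (y / lam N) / lam N) atTop (nhds (-BB y)) := by
  have e : ∀ k : ℕ, 1 / ((k+1).factorial : ℝ) ^ 2 * (k + 1) = 1 / (k.factorial * (k+1).factorial) := by
    intro k
    rw [Nat.factorial_succ]; push_cast
    have : (k.factorial : ℝ) ≠ 0 := by positivity
    field_simp
  have := tendsto_tsum_of_dominated_convergence (𝓕 := atTop)
    (f := fun N k => (-1 : ℝ) ^ k * (-(aco N (k + 1) * (k + 1))) * y ^ k)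
    (g := fun k => (-1 : ℝ) ^ k * (-(1 / ((k+1).factorial : ℝ) ^ 2 * (k + 1))) * y ^ k)
    (Real.summable_pow_div_factorial y) ?_ ?_
  · have e2 : ∑' k : ℕ, (-1 : ℝ) ^ k * (-(1 / ((k+1).factorial : ℝ) ^ 2 * (k + 1))) * y ^ k = -BB y := by
      unfold BB
      rw [← tsum_neg]
      congr 1; ext k
      rw [e]; ring
    rw [e2] at this
    refine this.congr' ?_
    filter_upwards [eventually_gt_atTop 0] with N hN
    exact (slp'_hasSum hN y).tsum_eq
  · intro k
    exact (((aco_tendsto (k+1)).mul_const _).neg.const_mul _).mul_const _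
  · filter_upwards [eventually_gt_atTop 0] with N hN k
    have h1 := aco_nonneg N (k+1)
    have h2 := aco_le hN (k+1)
    rw [norm_mul, norm_mul, norm_pow, norm_neg, norm_one, one_pow, one_mul, norm_neg,
      Real.norm_of_nonneg (by positivity), Real.norm_of_nonneg (by positivity)]
    calc _ ≤ 1 / ((k+1).factorial : ℝ) ^ 2 * (k + 1) * y ^ k := by gcongr
      _ = 1 / (k.factorial * (k+1).factorial) * y ^ k := by rw [e]
      _ ≤ 1 / k.factorial * y ^ k := by
        gcongr
        have := fac_one_le k
        have := fac_one_le (k+1)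
        nlinarith
      _ = _ := by ring

lemma Son_tendsto {y : ℝ} (hy : 0 ≤ y) :
    Tendsto (fun N => Son N (y / lam N)) atTop (nhds (BA y ^ 2 + y * BB y ^ 2)) := by
  have h0 : Tendsto (fun N => y / lam N) atTop (nhds 0) := tendsto_const_nhds.div_atTop lam_tendsto
  have h1 := ((slp_tendsto hy).pow 2).add
    (((tendsto_const_nhds (x := (1:ℝ))).sub h0).const_mul y |>.mul ((slp'_tendsto hy).pow 2))
  have e : BA y ^ 2 + y * (1 - 0) * (-BB y) ^ 2 = BA y ^ 2 + y * BB y ^ 2 := by ring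
  rw [e] at h1
  refine h1.congr' ?_
  filter_upwards [eventually_gt_atTop 0] with N hN
  have := lam_pos hN
  unfold Son; field_simp

lemma E_anti {y z : ℝ} (hy : 0 ≤ y) (hz : y ≤ z) :
    BA z ^ 2 + z * BB z ^ 2 ≤ BA y ^ 2 + y * BB y ^ 2 := by
  refine le_of_tendsto_of_tendsto (Son_tendsto (hy.trans hz)) (Son_tendsto hy) ?_
  filter_upwards [eventually_gt_atTop 0, lam_tendsto.eventually_ge_atTop (2 * z)] with N hN hL
  have := lam_pos hN
  have h1 : z / lam N ≤ 1/2 := by rw [div_le_iff₀ this]; linarith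
  have h2 : y / lam N ≤ z / lam N := by gcongr
  exact Son_anti hN ⟨by positivity, h2.trans h1⟩ ⟨div_nonneg (hy.trans hz) this.le, h1⟩ h2

lemma BA_deriv (y : ℝ) : HasDerivAt BA (-BB y) y := by
  set R := |y| + 1
  have key := hasDerivAt_tsum_of_isPreconnected (t := Set.Ioo (-R) R) (𝕜 := ℝ) (F := ℝ)
    (g := fun (k : ℕ) y => (-1 : ℝ) ^ k * y ^ k / ((k.factorial : ℝ)) ^ 2)
    (g' := fun (k : ℕ) y => (-1 : ℝ) ^ k * (k * y ^ (k - 1)) / ((k.factorial : ℝ)) ^ 2)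
    (u := fun k : ℕ => k * R ^ (k-1) / ((k.factorial : ℝ)) ^ 2) (y := y) (y₀ := y) ?_ isOpen_Ioo
    isPreconnected_Ioo ?_ ?_ ?_ (summA y) ?_
  · refine key.congr_deriv ?_
    have hB := (summB y).hasSum.neg
    refine HasSum.tsum_eq ?_
    rw [← hasSum_nat_add_iff' 1]
    simp only [Finset.range_one, Finset.sum_singleton]
    convert! hB using 1
    · ext k
      rw [Nat.factorial_succ]; push_cast
      have : (k.factorial : ℝ) ≠ 0 := by positivity
      field_simp
      simp [pow_succ, mul_comm]
    · simp [BB]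
  · rw [← summable_nat_add_iff 1]
    have hR : 0 ≤ R := by positivity
    refine Summable.of_nonneg_of_le (fun k => by positivity) (fun k => ?_) (Real.summable_pow_div_factorial R)
    have := fac_one_le k
    have h2 : (k : ℝ) + 1 ≥ 1 := by simp
    rw [Nat.factorial_succ]; push_cast
    try simp only [add_tsub_cancel_right]
    rw [div_le_div_iff₀ (by positivity) (by positivity)]
    have : (k.factorial : ℝ) ≤ (k + 1) * k.factorial ^ 2 := by nlinarith
    calc _ = ((k + 1) * R ^ k) * (k.factorial : ℝ) := by ring
      _ ≤ ((k + 1) * R ^ k) * ((k + 1) * k.factorial ^ 2) := by gcongr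
      _ = _ := by ring
  · intro k z _
    exact ((hasDerivAt_pow k z).const_mul _).div_const _
  · intro k z hz
    have : |z| ≤ R := abs_le.2 ⟨hz.1.le, hz.2.le⟩
    rw [norm_div, norm_mul, norm_mul, norm_pow, norm_pow, norm_pow, norm_neg, norm_one, one_pow, one_mul]
    simp only [RCLike.norm_natCast, Real.norm_eq_abs]
    gcongr
  all_goals exact ⟨by have := neg_abs_le y; simp only [R]; linarith, by have := le_abs_self y; simp only [R]; linarith⟩

lemma alt_lower {a : ℕ → ℝ} (hs : Summable (fun k => (-1 : ℝ) ^ k * a k)) (m : ℕ)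
    (ha : ∀ k, 2 * m ≤ k → a (k + 1) ≤ a k) :
    ∑ k ∈ Finset.range (2 * m), (-1 : ℝ) ^ k * a k ≤ ∑' k, (-1 : ℝ) ^ k * a k := by
  rw [← hs.sum_add_tsum_nat_add (2 * m)]
  have e : ∀ k, (-1 : ℝ) ^ (k + 2 * m) * a (k + 2 * m) = (-1) ^ k * a (k + 2 * m) := by
    intro k; rw [pow_add, pow_mul]; norm_num
  have hs' : Summable (fun k => (-1 : ℝ) ^ k * a (k + 2 * m)) := by
    have := (summable_nat_add_iff (2 * m)).2 hs
    simpa only [e] using this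
  have := Antitone.alternating_series_le_tendsto (f := fun k => a (k + 2 * m)) hs'.hasSum.tendsto_sum_nat
    (antitone_nat_of_succ_le fun k => by
      have := ha (k + 2 * m) (by omega)
      rwa [show k + 1 + 2 * m = k + 2 * m + 1 by ring]) 0
  simp only [e]
  simp at this
  linarith

lemma alt_upper {a : ℕ → ℝ} (hs : Summable (fun k => (-1 : ℝ) ^ k * a k)) (m : ℕ)
    (ha : ∀ k, 2 * m ≤ k → a (k + 1) ≤ a k) :
    ∑' k, (-1 : ℝ) ^ k * a k ≤ ∑ k ∈ Finset.range (2 * m + 1), (-1 : ℝ) ^ k * a k := by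
  rw [← hs.sum_add_tsum_nat_add (2 * m), Finset.sum_range_succ]
  have e : ∀ k, (-1 : ℝ) ^ (k + 2 * m) * a (k + 2 * m) = (-1) ^ k * a (k + 2 * m) := by
    intro k; rw [pow_add, pow_mul]; norm_num
  have hs' : Summable (fun k => (-1 : ℝ) ^ k * a (k + 2 * m)) := by
    have := (summable_nat_add_iff (2 * m)).2 hs
    simpa only [e] using this
  have := Antitone.tendsto_le_alternating_series (f := fun k => a (k + 2 * m)) hs'.hasSum.tendsto_sum_nat
    (antitone_nat_of_succ_le fun k => by
      have := ha (k + 2 * m) (by omega)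
      rwa [show k + 1 + 2 * m = k + 2 * m + 1 by ring]) 0
  simp only [e]
  simp at this
  have e2 := e 0
  simp only [zero_add, pow_zero, one_mul] at e2
  linarith

lemma A_dec {y : ℝ} (h0 : 0 ≤ y) (h1 : y ≤ 4) (k : ℕ) (hk : 2 ≤ k) :
    y ^ (k+1) / (((k+1).factorial : ℝ)) ^ 2 ≤ y ^ k / ((k.factorial : ℝ)) ^ 2 := by
  have hk' : (2:ℝ) ≤ k := by exact_mod_cast hk
  rw [Nat.factorial_succ, pow_succ]; push_cast
  have : y ^ k * y / (((k : ℝ) + 1) * k.factorial) ^ 2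
    = y ^ k / (k.factorial : ℝ) ^ 2 * (y / ((k : ℝ) + 1) ^ 2) := by
    field_simp
  rw [this]
  refine mul_le_of_le_one_right (by positivity) ?_
  rw [div_le_one (by positivity)]; nlinarith

lemma B_dec {y : ℝ} (h0 : 0 ≤ y) (h1 : y ≤ 4) (k : ℕ) (hk : 2 ≤ k) :
    y ^ (k+1) / ((k+1).factorial * (k+1+1).factorial : ℝ) ≤ y ^ k / (k.factorial * (k+1).factorial : ℝ) := by
  have hk' : (2:ℝ) ≤ k := by exact_mod_cast hk
  rw [Nat.factorial_succ (k+1), Nat.factorial_succ k, pow_succ]; push_cast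
  have : y ^ k * y / (((k : ℝ) + 1) * k.factorial * (((k:ℝ)+1+1) * ((k + 1) * k.factorial)))
    = y ^ k / (k.factorial * ((k + 1) * k.factorial) : ℝ) * (y / (((k : ℝ) + 1) * (k + 2))) := by
    field_simp; ring
  rw [this]
  refine mul_le_of_le_one_right (by positivity) ?_
  rw [div_le_one (by positivity)]; nlinarith

lemma BA_eq (y : ℝ) : BA y = ∑' k : ℕ, (-1 : ℝ) ^ k * (y ^ k / ((k.factorial : ℝ)) ^ 2) := by
  unfold BA; simp only [mul_div_assoc]

lemma BB_eq (y : ℝ) : BB y = ∑' k : ℕ, (-1 : ℝ) ^ k * (y ^ k / (k.factorial * (k+1).factorial : ℝ)) := by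
  unfold BB; simp only [mul_div_assoc]

lemma BB_pos {y : ℝ} (h0 : 0 ≤ y) (h1 : y ≤ 3.61) : 0 < BB y := by
  rw [BB_eq]
  have hs := summB y
  simp only [mul_div_assoc] at hs
  refine lt_of_lt_of_le ?_ (alt_lower hs 3 fun k hk => B_dec h0 (by linarith) k (by omega))
  simp [Finset.sum_range_succ, Nat.factorial]
  obtain ⟨w, hw⟩ : ∃ w, w = 3.61 - y := ⟨_, rfl⟩
  have hw0 : 0 ≤ w := by linarith
  obtain rfl : y = 3.61 - w := by linarith
  ring_nf
  positivity

lemma BB_up : BB 3.61 ≤ 0.0068 := by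
  rw [BB_eq]
  have hs := summB 3.61
  simp only [mul_div_assoc] at hs
  refine (alt_upper hs 3 fun k hk => B_dec (by norm_num) (by norm_num) k (by omega)).trans ?_
  norm_num [Finset.sum_range_succ, Nat.factorial]

lemma BA_up : BA 3.61 ≤ -0.4 := by
  rw [BA_eq]
  have hs := summA 3.61
  simp only [mul_div_assoc] at hs
  refine (alt_upper hs 4 fun k hk => A_dec (by norm_num) (by norm_num) k (by omega)).trans ?_
  norm_num [Finset.sum_range_succ, Nat.factorial]

lemma BA_low : -0.4026 ≤ BA 3.61 := by
  rw [BA_eq]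
  have hs := summA 3.61
  simp only [mul_div_assoc] at hs
  refine le_trans ?_ (alt_lower hs 4 fun k hk => A_dec (by norm_num) (by norm_num) k (by omega))
  norm_num [Finset.sum_range_succ, Nat.factorial]

lemma sup_pos {N : ℕ} (hN : 0 < N) : sSup ((fun x => legPpos N x) '' Set.Icc (0:ℝ) 1) = 1 := by
  apply IsGreatest.csSup_eq
  constructor
  · refine ⟨1, by simp, ?_⟩
    have := legP_eq N 0
    rw [slp_zero] at this
    simp at this
    simp [legPpos, this]
  · rintro _ ⟨x, hx, rfl⟩
    have := legP_eq N ((1 - x) / 2)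
    rw [show 1 - 2 * ((1 - x) / 2) = x by ring] at this
    simp only [legPpos, this]
    have h := abs_slp_le hN (u := (1 - x)/2) (by linarith [hx.2]) (by linarith [hx.1])
    exact max_le (abs_le.1 h).2 zero_le_one

lemma neg_tendsto {y : ℝ} (hy : 0 < y) (hB : BB y = 0) (hA : BA y < 0)
    (hmin : ∀ z, 0 ≤ z → z ≤ y → BA y ≤ BA z) :
    Tendsto (fun N => sSup ((fun x => legPneg N x) '' Set.Icc (0:ℝ) 1)) atTop (nhds |BA y|) := by
  have hub : ∀ᶠ N in atTop, ∀ x ∈ Set.Icc (0:ℝ) 1,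
      legPneg N x ≤ max (√(Son N (y / lam N))) (|BA y| + err y N) := by
    filter_upwards [eventually_gt_atTop 0, lam_tendsto.eventually_ge_atTop (2 * y)] with N hN hL x hx
    have hl := lam_pos hN
    have h1 : y / lam N ≤ 1/2 := by rw [div_le_iff₀ hl]; linarith
    have h0 : 0 ≤ y / lam N := by positivity
    have := legP_eq N ((1 - x) / 2)
    rw [show 1 - 2 * ((1 - x) / 2) = x by ring] at this
    simp only [legPneg, this]
    have hu0 : 0 ≤ (1 - x)/2 := by linarith [hx.2]
    have hu1 : (1 - x)/2 ≤ 1/2 := by linarith [hx.1]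
    refine max_le ?_ (le_max_of_le_left (Real.sqrt_nonneg _))
    rcases le_total (y / lam N) ((1 - x)/2) with h | h
    · refine le_max_of_le_left ?_
      apply Real.le_sqrt_of_sq_le
      rw [neg_sq]
      exact (sq_le_Son hN hu0 hu1).trans (Son_anti hN ⟨h0, h1⟩ ⟨hu0, hu1⟩ h)
    · refine le_max_of_le_right ?_
      set u := (1 - x)/2
      have hz : u * lam N ≤ y := by rwa [le_div_iff₀ hl] at h
      have hz0 : 0 ≤ u * lam N := by positivity
      have h3 := slp_err hz0 hz hN
      rw [mul_div_cancel_right₀ _ hl.ne'] at h3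
      have h4 := hmin _ hz0 hz
      rw [abs_of_neg hA]
      linarith [(abs_le.1 h3).1]
  have hlow : Tendsto (fun N => -(slp N).eval (y / lam N)) atTop (nhds |BA y|) := by
    rw [abs_of_neg hA]; exact (slp_tendsto hy.le).neg
  have hup : Tendsto (fun N => max (√(Son N (y / lam N))) (|BA y| + err y N)) atTop (nhds |BA y|) := by
    have h1 := (Son_tendsto hy.le).sqrt
    rw [hB] at h1
    have e : BA y ^ 2 + y * 0 ^ 2 = BA y ^ 2 := by ring
    rw [e, Real.sqrt_sq_eq_abs] at h1
    have h2 := (err_tendsto hy.le).const_add |BA y|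
    rw [add_zero] at h2
    simpa using h1.max h2
  refine tendsto_of_tendsto_of_tendsto_of_le_of_le' hlow hup ?_ ?_
  · filter_upwards [hub, eventually_gt_atTop 0, lam_tendsto.eventually_ge_atTop (2 * y)] with N hb hN hL
    have hl := lam_pos hN
    have h1 : y / lam N ≤ 1/2 := by rw [div_le_iff₀ hl]; linarith
    have h0 : 0 ≤ y / lam N := by positivity
    refine le_trans ?_ (le_csSup ?_ ⟨1 - 2 * (y / lam N), ⟨by linarith, by linarith⟩, rfl⟩)
    · simp only [legPneg, legP_eq]
      exact le_max_left _ _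
    · exact ⟨_, by rintro _ ⟨x, hx, rfl⟩; exact hb x hx⟩
  · filter_upwards [hub] with N hb
    refine csSup_le ⟨_, ⟨0, by simp, rfl⟩⟩ ?_
    rintro _ ⟨x, hx, rfl⟩; exact hb x hx

/-- The ratio of sup-norms on $[0,1]$ of the positive and negative parts of the even
Legendre polynomials tends to $1/|J_0(j_1)|$, where $j_1$ is the smallest positive
zero of $J_1$; this limit is at least $2.48$. -/
theorem sup_norm_ratio_tendsto
    (j1 : ℝ) (hj1 : IsLeast {x : ℝ | 0 < x ∧ besselJ1 x = 0} j1) :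
    Filter.Tendsto (fun n : ℕ =>
        (sSup ((fun x => legPpos (2 * n) x) '' Set.Icc (0:ℝ) 1)) /
        (sSup ((fun x => legPneg (2 * n) x) '' Set.Icc (0:ℝ) 1)))
      Filter.atTop (nhds (1 / |besselJ0 j1|)) ∧
    (2.48 : ℝ) ≤ 1 / |besselJ0 j1| := by
  obtain ⟨⟨hj0, hjz⟩, hleast⟩ := hj1
  rw [J0_eq]
  rw [J1_eq] at hjz
  obtain ⟨y, hy⟩ : ∃ y, y = j1 ^ 2 / 4 := ⟨_, rfl⟩
  rw [← hy] at hjz ⊢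
  have hy0 : 0 < y := by rw [hy]; positivity
  have hB : BB y = 0 := by
    rcases mul_eq_zero.1 hjz with h | h
    · linarith
    · exact h
  have hy1 : 3.61 < y := by
    by_contra! h
    exact (BB_pos hy0.le h).ne' hB
  have hne : ∀ z ∈ Set.Ico 0 y, -BB z ≠ 0 := by
    rintro z ⟨hz0, hzy⟩ hz
    rcases hz0.eq_or_lt with rfl | hz0
    · have := BB_pos le_rfl (by norm_num : (0:ℝ) ≤ 3.61)
      linarith
    have hs : 0 < √z := Real.sqrt_pos.2 hz0
    have hm := hleast (a := 2 * √z) ⟨by positivity, by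
      rw [J1_eq, mul_pow, Real.sq_sqrt hz0.le, show (2:ℝ)^2 * z / 4 = z by ring, neg_eq_zero.1 hz, mul_zero]⟩
    have : j1 ^ 2 ≤ (2 * √z) ^ 2 := by gcongr
    rw [mul_pow, Real.sq_sqrt hz0.le] at this
    linarith
  have hsign : ∀ z ∈ Set.Ico 0 y, -BB z < 0 := by
    rcases hasDerivWithinAt_forall_lt_or_forall_gt_of_forall_ne (convex_Ico 0 y)
      (fun z _ => (BA_deriv z).hasDerivWithinAt) hne with h | h
    · exact h
    · have h1 := h 0 ⟨le_rfl, hy0⟩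
      have := BB_pos le_rfl (by norm_num : (0:ℝ) ≤ 3.61)
      linarith
  have hanti : AntitoneOn BA (Set.Icc 0 y) := by
    apply antitoneOn_of_deriv_nonpos (convex_Icc _ _)
    · exact fun u _ => (BA_deriv u).continuousAt.continuousWithinAt
    · exact fun u _ => (BA_deriv u).differentiableAt.differentiableWithinAt
    · intro u hu
      rw [interior_Icc] at hu
      rw [(BA_deriv u).deriv]
      exact (hsign u ⟨hu.1.le, hu.2⟩).le
  have hA : BA y < 0 := by
    have := hanti (a := 3.61) ⟨by norm_num, hy1.le⟩ ⟨hy0.le, le_rfl⟩ hy1.le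
    linarith [BA_up]
  have hpos : 0 < |BA y| := abs_pos.2 hA.ne
  constructor
  · have h1 := neg_tendsto hy0 hB hA (fun z h0 h1 => hanti ⟨h0, h1⟩ ⟨hy0.le, le_rfl⟩ h1)
    have h2 : Tendsto (fun n : ℕ => 2 * n) atTop atTop :=
      tendsto_id.const_mul_atTop' (by norm_num)
    have h3 := (tendsto_const_nhds (x := (1:ℝ))).div (h1.comp h2) hpos.ne'
    refine h3.congr' ?_
    filter_upwards [eventually_gt_atTop 0] with n hn
    simp only [Function.comp, Pi.div_apply]
    rw [sup_pos (by omega)]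
  · rw [le_div_iff₀ hpos]
    have hE := E_anti (y := 3.61) (by norm_num) hy1.le
    rw [hB] at hE
    have b1 := BB_pos (y := 3.61) (by norm_num) le_rfl
    have b2 := BB_up
    have a1 := BA_up
    have a2 := BA_low
    have hA2 : BA 3.61 ^ 2 ≤ 0.4026 ^ 2 := by nlinarith
    have hB2 : BB 3.61 ^ 2 ≤ 0.0068 ^ 2 := by gcongr
    have : |BA y| ^ 2 ≤ (1 / 2.48) ^ 2 := by
      rw [sq_abs]
      norm_num at hA2 hB2 hE ⊢
      linarith
    have := abs_le_of_sq_le_sq this (by norm_num)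
    rw [abs_abs] at this
    norm_num at this ⊢
    linarith
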